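/- Let F be an algebraically closed field of characteristic 0 and let g be a finite-dimensional simple Lie algebra over F with dim g = 14 (type G2), equipped with a grading by (ℤ/2ℤ)^3 such that dim g_α = 2 for every nonzero α ∈ (ℤ/2ℤ)^3. Then for every nonzero α ∈ (ℤ/2ℤ)^3, the homogeneous component g_α is a Cartan subalgebra of g. -/

import Mathlib

open Module

/-- A grading of the Lie algebra `L` over `F` by the additive group `A`:
a direct sum decomposition into subspaces compatible with the bracket. -/
def IsLieGrading (F : Type*) {A L : Type*} [Field F] [AddCommGroup A] [DecidableEq A]
    [LieRing L] [LieAlgebra F L] (gr : A → Submodule F L) : Prop :=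
  DirectSum.IsInternal gr ∧
    ∀ a b : A, ∀ x ∈ gr a, ∀ y ∈ gr b, ⁅x, y⁆ ∈ gr (a + b)

lemma aeval_mul_sub_mul_aeval {K R : Type*} [CommRing K] [Ring R] [Algebra K R] {a b c : R}
    (hc : a * b - b * a = c) (hac : Commute a c) (p : Polynomial K) :
    p.aeval a * b - b * p.aeval a = p.derivative.aeval a * c := by
  induction p using Polynomial.induction_on' with
  | add p q hp hq => simp only [map_add, add_mul, mul_add, ← hp, ← hq]; abel
  | monomial n r =>
    have key : ∀ n : ℕ, a ^ n * b - b * a ^ n = n * a ^ (n - 1) * c := by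
      intro n
      induction n with
      | zero => simp
      | succ n ih =>
        have h1 : a ^ (n + 1) * b - b * a ^ (n + 1) =
            a * (a ^ n * b - b * a ^ n) + (a * b - b * a) * a ^ n := by
          rw [pow_succ']; noncomm_ring
        rw [h1, ih, hc, ← (hac.pow_left n).eq]
        rcases n with _ | n
        · simp
        · simp only [Nat.add_sub_cancel, pow_succ' a n, Nat.cast_add, Nat.cast_one, add_mul,
            one_mul, mul_add, mul_assoc, (Nat.cast_commute n a).symm.left_comm]
    simp only [Polynomial.aeval_monomial, Polynomial.derivative_monomial, map_mul, map_natCast]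
    rw [mul_assoc, ← mul_assoc b, ← Algebra.commutes r b, mul_assoc, ← mul_sub, key]
    simp only [mul_assoc]

/-- Jacobson's lemma: a commutator `c = a * b - b * a` which commutes with `a` is nilpotent. -/
lemma isNilpotent_of_commute_commutator {K V : Type*} [Field K] [CharZero K] [AddCommGroup V]
    [Module K V] [FiniteDimensional K V] {a b c : End K V}
    (hc : a * b - b * a = c) (hac : Commute a c) : IsNilpotent c := by
  have key : ∀ (n : ℕ) (p : Polynomial K), p ≠ 0 → p.natDegree ≤ n →
      ∀ m : ℕ, p.aeval a * c ^ m = 0 → IsNilpotent c := by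
    intro n
    induction n with
    | zero =>
      intro p hp hn m hm
      rw [Polynomial.eq_C_of_natDegree_le_zero hn] at hm hp
      refine ⟨m, ?_⟩
      simpa [← Algebra.smul_def, Polynomial.C_ne_zero.mp hp] using hm
    | succ n ih =>
      intro p hp hn m hm
      by_cases hd : p.natDegree = 0
      · exact ih p hp (by lia) m hm
      have hcomm (q : Polynomial K) : Commute (q.aeval a) (c ^ m) :=
        (Algebra.commute_of_mem_adjoin_singleton_of_commute
          (Polynomial.aeval_mem_adjoin_singleton K a) hac.symm).symm.pow_right m
      refine ih p.derivative (fun h => hd (Polynomial.derivative_eq_zero.mp h))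
        ((Polynomial.natDegree_derivative_le p).trans (by lia)) (m + 1 + m) ?_
      have hm' : c ^ m * p.aeval a = 0 := by rw [← (hcomm p).eq, hm]
      calc p.derivative.aeval a * c ^ (m + 1 + m)
          = (p.derivative.aeval a * c ^ m) * c * c ^ m := by
            rw [pow_add, pow_add, pow_one]; simp only [mul_assoc]
        _ = c ^ m * (p.derivative.aeval a * c) * c ^ m := by
            rw [(hcomm p.derivative).eq]; simp only [mul_assoc]
        _ = (c ^ m * p.aeval a) * b * c ^ m - c ^ m * b * (p.aeval a * c ^ m) := by
            rw [← aeval_mul_sub_mul_aeval hc hac p]; simp only [mul_assoc, mul_sub, sub_mul]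
        _ = 0 := by rw [hm, hm']; simp
  exact key _ (minpoly K a) (minpoly.ne_zero (Algebra.IsIntegral.isIntegral a)) le_rfl 0
    (by simp [minpoly.aeval])

namespace RootPairing

variable {ι R M N : Type*} [Fintype ι] [Field R] [CharZero R] [AddCommGroup M] [Module R M]
  [AddCommGroup N] [Module R N] {P : RootPairing ι R M N}

/-- Exactly half of the roots are positive. -/
lemma Base.card_eq_two_mul_card_isPos (b : P.Base) [DecidablePred b.IsPos] :
    Fintype.card ι = 2 * (Finset.univ.filter b.IsPos).card := by
  let := P.indexNeg
  have h : (Finset.univ.filter fun i => ¬ b.IsPos i).card = (Finset.univ.filter b.IsPos).card := by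
    refine Finset.card_bij (fun i _ => -i) (fun i hi => ?_) (fun _ _ _ _ h => neg_injective h)
      fun i hi => ⟨-i, ?_, neg_neg i⟩
    · simpa only [Finset.mem_filter, Finset.mem_univ, true_and, Base.IsPos.neg_iff_not] using hi
    · simpa only [Finset.mem_filter, Finset.mem_univ, true_and, Base.IsPos.neg_iff_not,
        not_not] using hi
  rw [← Finset.card_univ, ← Finset.card_filter_add_card_filter_not (s := Finset.univ) b.IsPos, h]
  ring

variable [P.IsCrystallographic] [P.IsReduced] [P.IsIrreducible]

lemma Base.exists_root_eq_add (b : P.Base) (h : 2 ≤ b.support.card) {i : ι} (hi : i ∈ b.support) :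
    ∃ j ∈ b.support, j ≠ i ∧ P.root i + P.root j ∈ Set.range P.root := by
  classical
  by_contra! hc
  obtain ⟨k, hk, hki⟩ := Finset.exists_mem_ne (by lia : 1 < b.support.card) i
  have := b.induction_on_cartanMatrix (fun j => j = ⟨i, hi⟩) (i := ⟨i, hi⟩) (j := ⟨k, hk⟩) rfl ?_
  · exact hki (by simpa using this)
  · rintro _ j rfl hj
    by_contra hne
    apply hj
    rw [b.cartanMatrix_apply_eq_zero_iff hne, add_comm]
    exact hc j j.2 (by simpa [Subtype.ext_iff] using hne)

/-- In rank at least three there are at least two non-simple positive roots. -/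
lemma Base.card_support_add_two_le (b : P.Base) [DecidablePred b.IsPos]
    (h : 3 ≤ b.support.card) :
    b.support.card + 2 ≤ (Finset.univ.filter b.IsPos).card := by
  classical
  obtain ⟨i, hi⟩ : b.support.Nonempty := Finset.card_pos.mp (by lia)
  obtain ⟨j, hj, hji, e, he⟩ := b.exists_root_eq_add (by lia) hi
  obtain ⟨k, hk, hkij⟩ : ∃ k ∈ b.support, k ∉ ({i, j} : Finset ι) :=
    Finset.exists_mem_notMem_of_card_lt_card (lt_of_le_of_lt Finset.card_le_two (by lia))
  obtain ⟨l, hl, hlk, f, hf⟩ := b.exists_root_eq_add (by lia) hk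
  have hei := b.height_add he
  have hfi := b.height_add hf
  rw [height_one_of_mem_support hi, height_one_of_mem_support hj] at hei
  rw [height_one_of_mem_support hk, height_one_of_mem_support hl] at hfi
  have hes : e ∉ b.support := fun h => by rw [height_one_of_mem_support h] at hei; lia
  have hfs : f ∉ b.support := fun h => by rw [height_one_of_mem_support h] at hfi; lia
  have hef : e ≠ f := by
    rintro rfl
    simp only [Finset.mem_insert, Finset.mem_singleton, not_or] at hkij
    have : Nonempty ι := ⟨i⟩
    have h1 : (b.toWeightBasis.repr (P.root e)) ⟨k, hk⟩ = 0 := by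
      rw [he, map_add, b.toWeightBasis_repr_root ⟨i, hi⟩, b.toWeightBasis_repr_root ⟨j, hj⟩]
      simp [Ne.symm hkij.1, Ne.symm hkij.2]
    rw [hf, map_add, b.toWeightBasis_repr_root ⟨k, hk⟩, b.toWeightBasis_repr_root ⟨l, hl⟩] at h1
    simp [hlk] at h1
  calc b.support.card + 2 = (insert e (insert f b.support)).card := by
        rw [Finset.card_insert_of_notMem (by simp [hef, hes]), Finset.card_insert_of_notMem hfs]
    _ ≤ _ := by
        refine Finset.card_le_card fun m hm => ?_
        simp only [Finset.mem_insert] at hm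
        simp only [Finset.mem_filter, Finset.mem_univ, true_and]
        rcases hm with rfl | rfl | hm
        · rw [b.isPos_iff]; lia
        · rw [b.isPos_iff]; lia
        · exact isPos_of_mem_support hm

end RootPairing

lemma DirectSum.IsInternal.finrank_eq_sum {K V ι : Type*} [Field K] [AddCommGroup V] [Module K V]
    [FiniteDimensional K V] [Fintype ι] [DecidableEq ι] {N : ι → Submodule K V}
    (h : DirectSum.IsInternal N) : finrank K V = ∑ i, finrank K (N i) := by
  rw [← (LinearEquiv.ofBijective (DirectSum.coeLinearMap N) h).finrank_eq,
    Module.finrank_directSum]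

namespace LieAlgebra.IsKilling

variable {K L : Type*} [Field K] [CharZero K] [IsAlgClosed K] [LieRing L] [LieAlgebra K L]
  [FiniteDimensional K L] [IsKilling K L] (H : LieSubalgebra K L) [H.IsCartanSubalgebra]

lemma finrank_eq_finrank_cartan_add_card_root [Nontrivial L] :
    finrank K L = finrank K H + H.root.card := by
  classical
  let := Fintype.ofFinite (LieModule.Weight K H L)
  have h := DirectSum.isInternal_submodule_of_iSupIndep_of_iSup_eq_top
    (LieSubmodule.iSupIndep_toSubmodule.mpr <| LieModule.iSupIndep_genWeightSpace' K H L)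
    (LieSubmodule.iSup_toSubmodule_eq_top.mpr <| LieModule.iSup_genWeightSpace_eq_top' K H L)
  rw [h.finrank_eq_sum, ← Finset.sum_filter_add_sum_filter_not _ (fun χ => χ ∈ H.root), add_comm]
  congr 1
  · have : (Finset.univ.filter fun χ : LieModule.Weight K H L => χ ∉ H.root) = {0} := by
      ext χ; simp [LieModule.Weight.isZero_iff_eq_zero]
    rw [this, Finset.sum_singleton, FunLike.coe_zero,
      show LieModule.genWeightSpace L (0 : H → K) = H.toLieSubmodule from rootSpace_zero_eq K L H,
      LieSubalgebra.coe_toLieSubmodule]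
    rfl
  · rw [Finset.card_eq_sum_ones]
    refine Finset.sum_congr (by ext; simp) fun χ hχ => ?_
    exact finrank_rootSpace_eq_one χ (by simpa using hχ)

lemma finrank_cartan_le_two [IsSimple K L] (hL : finrank K L = 14) : finrank K H ≤ 2 := by
  classical
  have : Nontrivial L := Module.nontrivial_of_finrank_pos (R := K) (by lia)
  obtain ⟨b⟩ := (rootSystem H).nonempty_base
  have h1 := finrank_eq_finrank_cartan_add_card_root H
  have h2 := b.card_eq_two_mul_card_isPos
  have h3 := b.card_support_add_two_le
  have h4 : finrank K H = b.support.card := by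
    rw [← Subspace.dual_finrank_eq, Module.finrank_eq_card_basis b.toWeightBasis, Fintype.card_coe]
  rw [Fintype.card_coe] at h2
  lia

end LieAlgebra.IsKilling

namespace LieAlgebra

variable {F L : Type*} [Field F] [LieRing L] [LieAlgebra F L]

/-- The subalgebra of elements commuting with every element of `V`. -/
def centralizer (V : Submodule F L) : LieSubalgebra F L where
  carrier := {x | ∀ h ∈ V, ⁅h, x⁆ = 0}
  add_mem' hx hy h hh := by simp [hx h hh, hy h hh]
  zero_mem' := by simp
  smul_mem' c x hx h hh := by simp [hx h hh]
  lie_mem' {x y} hx hy h hh := by simp [leibniz_lie, hx h hh, hy h hh]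

/-- An abelian subspace whose elements `h` satisfy `ker ((ad h) ^ 2) = ker (ad h)` is contained in a
Cartan subalgebra. -/
lemma exists_isCartanSubalgebra_ge [FiniteDimensional F L] [Infinite F] (V : Submodule F L)
    (hV : ∀ x ∈ V, ∀ y ∈ V, ⁅x, y⁆ = 0) (hss : ∀ h ∈ V, ∀ x : L, ⁅h, ⁅h, x⁆⁆ = 0 → ⁅h, x⁆ = 0) :
    ∃ H : LieSubalgebra F L, H.IsCartanSubalgebra ∧ V ≤ H.toSubmodule := by
  obtain ⟨z, hz⟩ := LieAlgebra.exists_isCartanSubalgebra_engel F (centralizer V)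
  set H' := LieSubalgebra.engel F z
  have hmem : ∀ x, x ∈ H'.map (centralizer V).incl ↔ ∃ h : x ∈ centralizer V, ⟨x, h⟩ ∈ H' := by
    intro x
    simp [LieSubalgebra.mem_map]
  have hle : V ≤ (H'.map (centralizer V).incl).toSubmodule := by
    intro h hh
    refine (hmem h).mpr ⟨fun k hk => hV k hk h hh, ?_⟩
    rw [← hz.self_normalizing, LieSubalgebra.mem_normalizer_iff]
    rintro y -
    have : ⁅(⟨h, fun k hk => hV k hk h hh⟩ : centralizer V), y⁆ = 0 := Subtype.ext (y.2 h hh)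
    rw [this]
    exact H'.zero_mem
  refine ⟨H'.map (centralizer V).incl, ⟨?_, ?_⟩, hle⟩
  · exact (LieEquiv.nilpotent_iff_equiv_nilpotent
      (H'.equivMapOfInjective _ Subtype.val_injective)).mp hz.nilpotent
  · refine le_antisymm (fun x hx => ?_) (LieSubalgebra.le_normalizer _)
    rw [LieSubalgebra.mem_normalizer_iff] at hx
    have hxC : x ∈ centralizer V := by
      intro h hh
      refine hss h hh x ?_
      obtain ⟨hc, -⟩ := (hmem _).mp (hx h (hle hh))
      rw [← lie_skew h x, lie_neg, hc h hh, neg_zero]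
    refine (hmem x).mpr ⟨hxC, ?_⟩
    rw [← hz.self_normalizing, LieSubalgebra.mem_normalizer_iff]
    intro y hy
    exact ((hmem _).mp (hx y ((hmem _).mpr ⟨y.2, hy⟩))).2

lemma commute_ad_of_lie_eq_zero {R L : Type*} [CommRing R] [LieRing L] [LieAlgebra R L] {x y : L}
    (hxy : ⁅x, y⁆ = 0) : Commute (ad R L x) (ad R L y) :=
  LinearMap.ext fun z => by simp [leibniz_lie x y, hxy]

lemma killingForm_eq_zero_of_isNilpotent {F L : Type*} [Field F] [LieRing L] [LieAlgebra F L]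
    [FiniteDimensional F L] {x y : L} (hx : IsNilpotent (ad F L x)) (hxy : ⁅x, y⁆ = 0) :
    killingForm F L x y = 0 := by
  rw [killingForm_apply_apply]
  exact (LinearMap.isNilpotent_trace_of_isNilpotent
    ((commute_ad_of_lie_eq_zero hxy).isNilpotent_mul_right hx)).eq_zero

end LieAlgebra

namespace IsLieGrading

variable {F A L : Type*} [Field F] [AddCommGroup A] [DecidableEq A]
    [LieRing L] [LieAlgebra F L] [FiniteDimensional F L] {gr : A → Submodule F L}

lemma killingForm_eq_zero (hgr : IsLieGrading F gr) {a b : A} (hab : a + b ≠ 0) {x y : L}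
    (hx : x ∈ gr a) (hy : y ∈ gr b) : killingForm F L x y = 0 := by
  rw [killingForm_apply_apply]
  refine LinearMap.trace_eq_zero_of_mapsTo_ne hgr.1 (fun i => (a + b) + i) (by simpa using hab) ?_
  intro i z hz
  simpa [add_assoc] using hgr.2 _ _ x hx _ (hgr.2 _ _ y hy z hz)

/-- In a grading with trivial neutral component, there are no nonzero homogeneous nilpotents. -/
lemma eq_zero_of_isNilpotent [LieAlgebra.IsKilling F L] (hgr : IsLieGrading F gr) (h0 : gr 0 = ⊥)
    {a : A} {x : L} (hx : x ∈ gr a) (hnil : IsNilpotent (LieAlgebra.ad F L x)) : x = 0 := by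
  have h : ∀ y, killingForm F L x y = 0 := by
    intro y
    have hy : y ∈ ⨆ b, gr b := by rw [hgr.1.submodule_iSup_eq_top]; trivial
    induction hy using Submodule.iSup_induction' with
    | mem b y hy =>
      by_cases hab : a + b = 0
      · refine LieAlgebra.killingForm_eq_zero_of_isNilpotent hnil ?_
        simpa [hab, h0] using hgr.2 _ _ x hx y hy
      · exact hgr.killingForm_eq_zero hab hx hy
    | zero => simp
    | add y z _ _ hy hz => rw [map_add, hy, hz, add_zero]
  have := LieAlgebra.IsKilling.ker_killingForm_eq_bot F L
  exact (LinearMap.ker_eq_bot'.mp this) x (LinearMap.ext h)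

lemma lie_eq_zero_of_lie_lie_eq_zero [CharZero F] [LieAlgebra.IsKilling F L]
    (hgr : IsLieGrading F gr) (h0 : gr 0 = ⊥) {a : A} {h : L} (hh : h ∈ gr a) (x : L)
    (hx : ⁅h, ⁅h, x⁆⁆ = 0) : ⁅h, x⁆ = 0 := by
  have hom : ∀ b, ∀ y ∈ gr b, ⁅h, ⁅h, y⁆⁆ = 0 → ⁅h, y⁆ = 0 := by
    intro b y hy hhy
    refine hgr.eq_zero_of_isNilpotent h0 (hgr.2 _ _ h hh y hy) ?_
    refine isNilpotent_of_commute_commutator (a := LieAlgebra.ad F L h) (b := LieAlgebra.ad F L y)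
      (LinearMap.ext fun z => by simp) (LieAlgebra.commute_ad_of_lie_eq_zero hhy)
  let := hgr.1.chooseDecomposition
  have hcomp : ∀ b, ⁅h, ⁅h, (DirectSum.decompose gr x b : L)⁆⁆ = 0 := by
    classical
    intro b
    have hmem : ∀ c, ⁅h, ⁅h, (DirectSum.decompose gr x c : L)⁆⁆ ∈ gr (a + (a + c)) := fun c =>
      hgr.2 _ _ h hh _ (hgr.2 _ _ h hh _ (SetLike.coe_mem _))
    have hsum : ∑ c ∈ (DirectSum.decompose gr x).support,
        ⁅h, ⁅h, (DirectSum.decompose gr x c : L)⁆⁆ = 0 := by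
      rw [← lie_sum, ← lie_sum, DirectSum.sum_support_decompose, hx]
    have h1 := congrArg (fun z => (DirectSum.decompose gr z (a + (a + b)) : L)) hsum
    simp only [DirectSum.decompose_sum, DirectSum.decompose_zero, DirectSum.zero_apply,
      ZeroMemClass.coe_zero] at h1
    rw [DirectSum.sum_apply, AddSubmonoidClass.coe_finsetSum, Finset.sum_eq_single b,
        DirectSum.decompose_of_mem_same _ (hmem b)] at h1
    · exact h1
    · intro c _ hcb
      exact DirectSum.decompose_of_mem_ne _ (j := a + (a + b)) (hmem c) (by simpa using hcb)
    · intro hb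
      simp [DFinsupp.notMem_support_iff.mp hb]
  classical
  rw [← DirectSum.sum_support_decompose gr x, lie_sum]
  exact Finset.sum_eq_zero fun b _ => hom b _ (SetLike.coe_mem _) (hcomp b)

end IsLieGrading

theorem components_are_cartan_G2
    (F : Type*) [Field F] [IsAlgClosed F] [CharZero F]
    (L : Type*) [LieRing L] [LieAlgebra F L] [FiniteDimensional F L]
    [LieAlgebra.IsSimple F L] (hdim : finrank F L = 14)
    (gr : (Fin 3 → ZMod 2) → Submodule F L) (hgr : IsLieGrading F gr)
    (hdims : ∀ a : Fin 3 → ZMod 2, a ≠ 0 → finrank F (gr a) = 2) :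
    ∀ α : Fin 3 → ZMod 2, α ≠ 0 →
      ∃ H : LieSubalgebra F L, H.toSubmodule = gr α ∧ H.IsCartanSubalgebra := by
  intro α hα
  have h0 : gr 0 = ⊥ := by
    have h := hgr.1.finrank_eq_sum
    rw [hdim, ← Finset.add_sum_erase _ _ (Finset.mem_univ 0),
      Finset.sum_congr rfl fun a ha => hdims a (Finset.ne_of_mem_erase ha)] at h
    simpa using h
  have hself : α + α = 0 := by ext i; exact CharTwo.add_self_eq_zero _
  obtain ⟨H, hH, hle⟩ := LieAlgebra.exists_isCartanSubalgebra_ge (gr α)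
    (fun x hx y hy => by simpa [hself, h0] using hgr.2 _ _ x hx y hy)
    (fun h hh x => hgr.lie_eq_zero_of_lie_lie_eq_zero h0 hh x)
  refine ⟨H, (Submodule.eq_of_le_of_finrank_le hle ?_).symm, hH⟩
  rw [hdims α hα]
  exact LieAlgebra.IsKilling.finrank_cartan_le_two H hdim
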